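/- Let f(x) = ∑_{k ∈ ℕ₀^d} a_k x^k be an analytic function on (0,1)^d given by a power series with ∑_{k ∈ ℕ₀^d} |a_k| ≤ F. There exist constants c₁, c₂, c₃ > 0 depending only on d such that for every ε, δ ∈ (0,1) there exist a depth L ≤ c₁(1 + log₂(1/δ))(1 + log₂(1/ε))², a width vector p with input dimension p_0 = d + 1, output dimension 1 and ‖p‖_∞ ≤ c₂ δ^{−(d+1)}(1 + log₂(1/ε))^{d+2}, and a neural network F_ε with the absolute value activation a(x) = |x|, depth L and width vector p, satisfying ‖F_ε‖_× ≤ c₃ F (d+1) δ^{−5}(1 + log₂(1/ε))⁵ and |F_ε(1, x) − f(x)| ≤ 2Fε/δ² for all x ∈ (0, 1−δ]^d. -/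

import Mathlib

open scoped BigOperators
open Matrix

noncomputable section

/-- A bias-free neural network with width function `p`: for each `i`,
a real weight matrix of size `p (i+1) × p i`. -/
structure NN (p : ℕ → ℕ) where
  W : ∀ i : ℕ, Matrix (Fin (p (i + 1))) (Fin (p i)) ℝ

namespace NN

variable {p : ℕ → ℕ}

/-- Forward pass: output after multiplying by `W i` (activation `α` applied
between consecutive matrices, but not after the last one). -/
def pre (α : ℝ → ℝ) (f : NN p) : (i : ℕ) → (Fin (p 0) → ℝ) → (Fin (p (i + 1)) → ℝ)
  | 0, x => f.W 0 *ᵥ x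
  | (i + 1), x => f.W (i + 1) *ᵥ fun j => α (f.pre α i x j)

/-- Evaluation of the network of depth `L` (i.e. using matrices `W 0, …, W L`). -/
def eval (α : ℝ → ℝ) (f : NN p) (L : ℕ) (x : Fin (p 0) → ℝ) : Fin (p (L + 1)) → ℝ :=
  f.pre α L x

/-- The product `|W i| ⬝ |W (i-1)| ⬝ ⋯ ⬝ |W 0|` of the entrywise absolute values of the
weight matrices. -/
def absProd (f : NN p) : (i : ℕ) → Matrix (Fin (p (i + 1))) (Fin (p 0)) ℝ
  | 0 => Matrix.of fun j k => |f.W 0 j k|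
  | (i + 1) => (Matrix.of fun j k => |f.W (i + 1) j k|) * f.absProd i

/-- `‖f‖_×`: the ℓ¹ norm (sum of absolute values of all entries) of the matrix
`|W L| ⬝ ⋯ ⬝ |W 0|`. -/
def normTimes (f : NN p) (L : ℕ) : ℝ :=
  ∑ j, ∑ k, |f.absProd L j k|

end NN

/-- The absolute value activation function. -/
def absAct : ℝ → ℝ := fun x => |x|


namespace NN

/-- Output of layer `i` before activation, for weights and input indexed by natural numbers, where
`post` is the state entering layer `i`. -/
def linOut (p : ℕ → ℕ) (M : ℕ → ℕ → ℕ → ℝ) (i : ℕ) (post : ℕ → ℝ) (j : ℕ) : ℝ :=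
  ∑ k ∈ Finset.range (p i), M i j k * post k

/-- State entering layer `i` of the absolute value network with weights indexed by natural
numbers. -/
def post (p : ℕ → ℕ) (M : ℕ → ℕ → ℕ → ℝ) (x : ℕ → ℝ) : ℕ → ℕ → ℝ
  | 0 => x
  | (i + 1) => fun j => |linOut p M i (post p M x i) j|

/-- Row sums of the product of the entrywise absolute values of the first `i` weight matrices. -/
def rowNorm (p : ℕ → ℕ) (M : ℕ → ℕ → ℕ → ℝ) : ℕ → ℕ → ℝ
  | 0 => fun _ => 1
  | (i + 1) => fun j => ∑ k ∈ Finset.range (p i), |M i j k| * rowNorm p M i k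

theorem post_succ (p : ℕ → ℕ) (M : ℕ → ℕ → ℕ → ℝ) (x : ℕ → ℝ) (i j : ℕ) :
    post p M x (i + 1) j = |linOut p M i (post p M x i) j| := rfl

theorem rowNorm_succ (p : ℕ → ℕ) (M : ℕ → ℕ → ℕ → ℝ) (i j : ℕ) :
    rowNorm p M (i + 1) j = ∑ k ∈ Finset.range (p i), |M i j k| * rowNorm p M i k := rfl

theorem rowNorm_nonneg (p : ℕ → ℕ) (M : ℕ → ℕ → ℕ → ℝ) (i j : ℕ) : 0 ≤ rowNorm p M i j := by
  induction i generalizing j with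
  | zero => simp [rowNorm]
  | succ i ih => exact Finset.sum_nonneg fun k _ => mul_nonneg (abs_nonneg _) (ih k)

theorem post_congr {p p' : ℕ → ℕ} {M M' : ℕ → ℕ → ℕ → ℝ} (x : ℕ → ℝ) (i : ℕ)
    (hp : ∀ j < i, p j = p' j) (hM : ∀ j < i, M j = M' j) : post p M x i = post p' M' x i := by
  induction i with
  | zero => rfl
  | succ i ih =>
    funext j
    simp only [post, linOut]
    rw [ih (fun j hj => hp j (by omega)) (fun j hj => hM j (by omega)), hp i (by omega),
      hM i (by omega)]

theorem rowNorm_congr {p p' : ℕ → ℕ} {M M' : ℕ → ℕ → ℕ → ℝ} (i : ℕ)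
    (hp : ∀ j < i, p j = p' j) (hM : ∀ j < i, M j = M' j) : rowNorm p M i = rowNorm p' M' i := by
  induction i with
  | zero => rfl
  | succ i ih =>
    funext j
    simp only [rowNorm]
    rw [ih (fun j hj => hp j (by omega)) (fun j hj => hM j (by omega)), hp i (by omega),
      hM i (by omega)]

/-- The network whose weights are given by functions on natural numbers. -/
def ofNat (p : ℕ → ℕ) (M : ℕ → ℕ → ℕ → ℝ) : NN p :=
  ⟨fun i => Matrix.of fun j k => M i j k⟩

theorem pre_ofNat (p : ℕ → ℕ) (M : ℕ → ℕ → ℕ → ℝ) (x : Fin (p 0) → ℝ) (y : ℕ → ℝ)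
    (hxy : ∀ j, x j = y j) (i : ℕ) (j : Fin (p (i + 1))) :
    (ofNat p M).pre absAct i x j = linOut p M i (post p M y i) j := by
  induction i with
  | zero =>
    simp only [pre, ofNat, Matrix.mulVec, dotProduct, linOut, post, Matrix.of_apply, hxy]
    exact (Finset.sum_range fun k => M 0 j k * y k).symm
  | succ i ih =>
    simp only [pre, Matrix.mulVec, dotProduct, ih, absAct]
    simp only [ofNat, Matrix.of_apply]
    exact (Finset.sum_range fun k => M (i + 1) j k * post p M y (i + 1) k).symm

theorem absProd_ofNat_nonneg (p : ℕ → ℕ) (M : ℕ → ℕ → ℕ → ℝ) (i : ℕ) (j : Fin (p (i + 1)))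
    (k : Fin (p 0)) : 0 ≤ (ofNat p M).absProd i j k := by
  induction i with
  | zero => simp [absProd]
  | succ i ih =>
    simp only [absProd, Matrix.mul_apply, Matrix.of_apply]
    exact Finset.sum_nonneg fun l _ => mul_nonneg (abs_nonneg _) (ih l)

theorem sum_absProd_ofNat (p : ℕ → ℕ) (M : ℕ → ℕ → ℕ → ℝ) (i : ℕ) (j : Fin (p (i + 1))) :
    ∑ k, (ofNat p M).absProd i j k = rowNorm p M (i + 1) j := by
  induction i with
  | zero =>
    simp only [absProd, ofNat, rowNorm, Matrix.of_apply, mul_one]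
    exact (Finset.sum_range fun k => |M 0 j k|).symm
  | succ i ih =>
    simp only [absProd, Matrix.mul_apply, Matrix.of_apply]
    rw [Finset.sum_comm]
    simp only [← Finset.mul_sum, ih]
    rw [rowNorm_succ, Finset.sum_range]
    rfl

/-- The functions `φ · k` on `X` are the entries of the state entering layer `i` of some absolute
value network with input dimension `n` and widths at most `B`; `ν` bounds the corresponding row
norms. -/
def Reach (n : ℕ) (X : Set (ℕ → ℝ)) (B i : ℕ) (κ : Type) (φ : (ℕ → ℝ) → κ → ℝ) (ν : κ → ℝ) :
    Prop :=
  ∃ (p : ℕ → ℕ) (M : ℕ → ℕ → ℕ → ℝ) (e : κ ≃ Fin (p i)), p 0 = n ∧ (∀ j ≤ i, p j ≤ B) ∧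
    (∀ x ∈ X, ∀ k, post p M x i (e k) = φ x k) ∧ ∀ k, rowNorm p M i (e k) ≤ ν k

variable {n B i : ℕ} {X : Set (ℕ → ℝ)} {κ κ' : Type} {φ : (ℕ → ℝ) → κ → ℝ} {ν : κ → ℝ}

theorem reach_input (h : n ≤ B) : Reach n X B 0 (Fin n) (fun x k => x k) fun _ => 1 :=
  ⟨fun _ => n, fun _ _ _ => 0, Equiv.refl _, rfl, fun _ _ => h, fun _ _ _ => rfl, fun _ => le_rfl⟩

theorem Reach.nonneg (h : Reach n X B i κ φ ν) (k : κ) : 0 ≤ ν k := by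
  obtain ⟨p, M, e, -, -, -, h⟩ := h
  exact (rowNorm_nonneg _ _ _ _).trans (h k)

theorem Reach.linOut [Fintype κ] [Fintype κ'] (h : Reach n X B i κ φ ν)
    (hB : Fintype.card κ' ≤ B) (A : κ' → κ → ℝ) :
    ∃ (p : ℕ → ℕ) (M : ℕ → ℕ → ℕ → ℝ) (e : κ' ≃ Fin (p (i + 1))), p 0 = n ∧
      (∀ j ≤ i + 1, p j ≤ B) ∧
      (∀ x ∈ X, ∀ k, linOut p M i (post p M x i) (e k) = ∑ l, A k l * φ x l) ∧
      ∀ k, rowNorm p M (i + 1) (e k) ≤ ∑ l, |A k l| * ν l := by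
  obtain ⟨p, M, e, h0, hpB, hφ, hν⟩ := h
  let e' := Fintype.equivFin κ'
  let p' : ℕ → ℕ := fun j => if j ≤ i then p j else Fintype.card κ'
  let A' : ℕ → ℕ → ℝ := fun a b =>
    if h : a < Fintype.card κ' ∧ b < p i then A (e'.symm ⟨a, h.1⟩) (e.symm ⟨b, h.2⟩) else 0
  let M' : ℕ → ℕ → ℕ → ℝ := fun j => if j < i then M j else A'
  have hpi : p' i = p i := by simp [p']
  have hps : p' (i + 1) = Fintype.card κ' := by simp [p']
  have hMi : M' i = A' := by simp [M']
  have hp : ∀ j < i, p' j = p j := fun j hj => by simp [p', hj.le]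
  have hM : ∀ j < i, M' j = M j := fun j hj => by simp [M', hj]
  have hA : ∀ k (l : Fin (p i)), A' (e' k) l = A k (e.symm l) := fun k l => by simp [A']
  refine ⟨p', M', e'.trans (finCongr hps.symm), by simp [p', h0], fun j hj => ?_,
    fun x hx k => ?_, fun k => ?_⟩
  · by_cases h : j ≤ i
    · simpa [p', h] using hpB j h
    · simpa [p', h] using hB
  · rw [NN.linOut, hpi, hMi, post_congr x i hp hM, Finset.sum_range]
    simp only [Equiv.trans_apply, finCongr_apply, Fin.val_cast, hA]
    rw [← e.sum_comp]
    simp [hφ x hx]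
  · rw [rowNorm_succ, hpi, hMi, rowNorm_congr i hp hM, Finset.sum_range]
    simp only [Equiv.trans_apply, finCongr_apply, Fin.val_cast, hA]
    rw [← e.sum_comp]
    simp only [Equiv.symm_apply_apply]
    exact Finset.sum_le_sum fun l _ => mul_le_mul_of_nonneg_left (hν l) (abs_nonneg _)

theorem Reach.step [Fintype κ] [Fintype κ'] (h : Reach n X B i κ φ ν)
    (hB : Fintype.card κ' ≤ B) {ψ : (ℕ → ℝ) → κ' → ℝ} {ν' : κ' → ℝ}
    (H : ∀ j, ∃ (k₁ k₂ k₃ : κ) (a b c : ℝ),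
      (∀ x ∈ X, |a * φ x k₁ + b * φ x k₂ + c * φ x k₃| = ψ x j) ∧
      |a| * ν k₁ + |b| * ν k₂ + |c| * ν k₃ ≤ ν' j) :
    Reach n X B (i + 1) κ' ψ ν' := by
  classical
  choose k₁ k₂ k₃ a b c hψ hν' using H
  obtain ⟨p, M, e, h0, hpB, hφ, hν⟩ := h.linOut hB fun j =>
    Pi.single (k₁ j) (a j) + Pi.single (k₂ j) (b j) + Pi.single (k₃ j) (c j)
  have key : ∀ (k : κ) (r : ℝ) (g : κ → ℝ), ∑ l, (Pi.single k r : κ → ℝ) l * g l = r * g k :=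
    fun k r g => by simp [Pi.single_apply]
  have key' : ∀ (k : κ) (r : ℝ) (g : κ → ℝ), ∑ l, |(Pi.single k r : κ → ℝ) l| * g l = |r| * g k :=
    fun k r g => by
      rw [Finset.sum_eq_single k] <;> simp +contextual
  refine ⟨p, M, e, h0, hpB, fun x hx j => ?_, fun j => ?_⟩
  · rw [post_succ, hφ x hx, ← hψ j x hx]
    simp only [Pi.add_apply, add_mul, Finset.sum_add_distrib, key]
  · refine (hν j).trans (le_trans ?_ (hν' j))
    rw [← key', ← key', ← key', ← Finset.sum_add_distrib, ← Finset.sum_add_distrib]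
    refine Finset.sum_le_sum fun l _ => ?_
    rw [← add_mul, ← add_mul]
    exact mul_le_mul_of_nonneg_right (abs_add_three _ _ _) (h.nonneg l)

end NN

/-- Iterates of the folding map `t ↦ |1 - 2t|`. -/
def foldIter : ℕ → ℝ → ℝ
  | 0, u => u
  | (s + 1), u => |1 - 2 * foldIter s u|

/-- Piecewise linear approximation of `u ^ 2` on `[0, 1]`. -/
def sqApprox : ℕ → ℝ → ℝ
  | 0, _ => 1
  | (s + 1), u => sqApprox s u - (1 - foldIter s u) / 4 ^ s

theorem foldIter_mem {u : ℝ} (hu : u ∈ Set.Icc (0 : ℝ) 1) (s : ℕ) :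
    foldIter s u ∈ Set.Icc (0 : ℝ) 1 := by
  induction s with
  | zero => exact hu
  | succ s ih => exact ⟨abs_nonneg _, abs_le.2 ⟨by linarith [ih.2], by linarith [ih.1]⟩⟩

theorem sqApprox_eq (u : ℝ) (s : ℕ) : sqApprox s u = u ^ 2 + (1 - foldIter s u ^ 2) / 4 ^ s := by
  induction s with
  | zero => simp [sqApprox, foldIter]
  | succ s ih =>
    rw [sqApprox, ih, foldIter, sq_abs]
    field_simp
    ring

theorem sq_le_sqApprox {u : ℝ} (hu : u ∈ Set.Icc (0 : ℝ) 1) (s : ℕ) : u ^ 2 ≤ sqApprox s u := by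
  obtain ⟨h0, h1⟩ := foldIter_mem hu s
  rw [sqApprox_eq]
  have : 0 ≤ (1 - foldIter s u ^ 2) / 4 ^ s := div_nonneg (by nlinarith) (by positivity)
  linarith

theorem sqApprox_le_add {u : ℝ} (s : ℕ) : sqApprox s u ≤ u ^ 2 + 1 / 4 ^ s := by
  rw [sqApprox_eq]
  gcongr
  nlinarith [sq_nonneg (foldIter s u)]

theorem sqApprox_le_one {u : ℝ} (hu : u ∈ Set.Icc (0 : ℝ) 1) (s : ℕ) : sqApprox s u ≤ 1 := by
  induction s with
  | zero => simp [sqApprox]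
  | succ s ih =>
    have : 0 ≤ (1 - foldIter s u) / 4 ^ s :=
      div_nonneg (by linarith [(foldIter_mem hu s).2]) (by positivity)
    rw [sqApprox]
    linarith

namespace NN

variable {n B i : ℕ} {X : Set (ℕ → ℝ)} {ι ι' : Type}

/-- State after `s` steps of the squaring recursion, together with a constant unit. -/
def sqState (u : (ℕ → ℝ) → ι → ℝ) (s : ℕ) (x : ℕ → ℝ) : Option (ι × Bool) → ℝ
  | none => 1
  | some (j, false) => foldIter s (u x j)
  | some (j, true) => sqApprox s (u x j)

/-- Row norm bounds for `sqState`. -/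
def sqStateNorm (c : ℝ) (s : ℕ) : Option (ι × Bool) → ℝ
  | none => 1
  | some (_, false) => 2 ^ s * (c + 1) - 1
  | some (_, true) => 1 + 2 * (c + 1) * (1 - 1 / 2 ^ s)

theorem Reach.sqState [Fintype ι] {u : (ℕ → ℝ) → ι → ℝ} {c : ℝ}
    (hu : ∀ x ∈ X, ∀ j, u x j ∈ Set.Icc (0 : ℝ) 1) (hB : Fintype.card (Option (ι × Bool)) ≤ B)
    (h : Reach n X B i (Option (ι × Bool)) (sqState u 0) (sqStateNorm c 0)) (s : ℕ) :
    Reach n X B (i + s) (Option (ι × Bool)) (NN.sqState u s) (sqStateNorm c s) := by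
  induction s with
  | zero => exact h
  | succ s ih =>
    refine ih.step hB ?_
    rintro (_ | ⟨j, _ | _⟩)
    · exact ⟨none, none, none, 1, 0, 0, by simp [NN.sqState], by simp [sqStateNorm]⟩
    · refine ⟨none, some (j, false), none, 1, -2, 0, fun x hx => ?_, ?_⟩
      · simp only [NN.sqState, foldIter]
        congr 1
        ring
      · simp only [sqStateNorm, abs_one, abs_neg, abs_zero, abs_two, pow_succ]
        linarith
    · refine ⟨some (j, true), none, some (j, false), 1, -(1 / 4 ^ s), 1 / 4 ^ s,
        fun x hx => ?_, ?_⟩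
      · simp only [NN.sqState]
        rw [abs_of_nonneg]
        · rw [sqApprox]; ring
        · refine (sq_nonneg (u x j)).trans ((sq_le_sqApprox (hu x hx j) (s + 1)).trans (le_of_eq ?_))
          rw [sqApprox]; ring
      · have h4 : (4 : ℝ) ^ s = 2 ^ s * 2 ^ s := by rw [← mul_pow]; norm_num
        have h2 : (2 : ℝ) ^ s ≠ 0 := by positivity
        simp only [sqStateNorm]
        rw [abs_neg, abs_of_nonneg (by positivity : (0 : ℝ) ≤ 1 / 4 ^ s), h4, pow_succ]
        apply le_of_eq
        simp only [abs_one]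
        field_simp
        ring

/-- After `i` layers a network provides a constant unit and approximations with error at most `e`
and values in `[0, 1]` of the functions `V · j`, with row norms at most `c`. -/
def Approximates (n : ℕ) (X : Set (ℕ → ℝ)) (B i : ℕ) (ι : Type) (V : (ℕ → ℝ) → ι → ℝ)
    (c e : ℝ) : Prop :=
  ∃ (φ : (ℕ → ℝ) → Option ι → ℝ) (ν : Option ι → ℝ), Reach n X B i (Option ι) φ ν ∧
    (∀ x ∈ X, φ x none = 1) ∧ ν none ≤ 1 ∧
    (∀ x ∈ X, ∀ j, φ x (some j) ∈ Set.Icc (0 : ℝ) 1) ∧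
    (∀ x ∈ X, ∀ j, |φ x (some j) - V x j| ≤ e) ∧ ∀ j, ν (some j) ≤ c

theorem abs_sqApprox_sub_le {a b : ℝ} (ha : a ∈ Set.Icc (0 : ℝ) 1) (hb : b ∈ Set.Icc (0 : ℝ) 1)
    (m : ℕ) :
    |sqApprox m (|(a + b) / 2|) - sqApprox m (|(a - b) / 2|)| ≤ 1 ∧
    |(|sqApprox m (|(a + b) / 2|) - sqApprox m (|(a - b) / 2|)|) - a * b| ≤ 1 / 4 ^ m := by
  obtain ⟨ha0, ha1⟩ := ha
  obtain ⟨hb0, hb1⟩ := hb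
  have h1 : |(a + b) / 2| ∈ Set.Icc (0 : ℝ) 1 :=
    ⟨abs_nonneg _, abs_le.2 ⟨by linarith, by linarith⟩⟩
  have h2 : |(a - b) / 2| ∈ Set.Icc (0 : ℝ) 1 :=
    ⟨abs_nonneg _, abs_le.2 ⟨by linarith, by linarith⟩⟩
  have l1 := sq_le_sqApprox h1 m
  have l2 := sq_le_sqApprox h2 m
  have u1 := sqApprox_le_add (u := |(a + b) / 2|) m
  have u2 := sqApprox_le_add (u := |(a - b) / 2|) m
  have o1 := sqApprox_le_one h1 m
  have o2 := sqApprox_le_one h2 m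
  rw [sq_abs] at l1 l2 u1 u2
  refine ⟨abs_le.2 ⟨by nlinarith, by nlinarith⟩, ?_⟩
  calc _ = |(|sqApprox m (|(a + b) / 2|) - sqApprox m (|(a - b) / 2|)|) - (|a * b|)| := by
        rw [abs_of_nonneg (mul_nonneg ha0 hb0)]
    _ ≤ _ := abs_abs_sub_abs_le _ _
    _ ≤ _ := abs_le.2 ⟨by nlinarith, by nlinarith⟩

theorem Approximates.mul [Fintype ι] [Fintype ι'] {V : (ℕ → ℝ) → ι → ℝ} {c e : ℝ}
    (h : Approximates n X B i ι V c e) (hV : ∀ x ∈ X, ∀ j, V x j ∈ Set.Icc (0 : ℝ) 1)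
    (hB : 4 * Fintype.card ι' + 1 ≤ B) (l r : ι' → ι) (m : ℕ) :
    Approximates n X B (i + (m + 2)) ι' (fun x j => V x (l j) * V x (r j)) (4 * c + 6)
      (2 * e + 1 / 4 ^ m) := by
  obtain ⟨φ, ν, hR, h1, hν1, hφ, hφV, hν⟩ := h
  let u : (ℕ → ℝ) → ι' × Bool → ℝ := fun x j =>
    bif j.2 then |(φ x (some (l j.1)) + φ x (some (r j.1))) / 2|
    else |(φ x (some (l j.1)) - φ x (some (r j.1))) / 2|
  have hu : ∀ x ∈ X, ∀ j, u x j ∈ Set.Icc (0 : ℝ) 1 := by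
    rintro x hx ⟨j, b⟩
    obtain ⟨h1, h2⟩ := hφ x hx (l j)
    obtain ⟨h3, h4⟩ := hφ x hx (r j)
    cases b <;> exact ⟨abs_nonneg _, abs_le.2 ⟨by linarith, by linarith⟩⟩
  have hcard : Fintype.card (Option ((ι' × Bool) × Bool)) ≤ B := by
    simp only [Fintype.card_option, Fintype.card_prod, Fintype.card_bool]
    omega
  have hstart : Reach n X B (i + 1) (Option ((ι' × Bool) × Bool)) (sqState u 0)
      (sqStateNorm c 0) := by
    refine hR.step hcard ?_
    rintro (_ | ⟨⟨j, b⟩, _ | _⟩)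
    · exact ⟨none, none, none, 1, 0, 0, fun x hx => by simp [sqState, h1 x hx],
        by simpa [sqStateNorm] using hν1⟩
    · refine ⟨some (l j), some (r j), none, 1 / 2, bif b then 1 / 2 else -(1 / 2), 0,
        fun x hx => ?_, ?_⟩
      · cases b <;> simp only [sqState, foldIter, u, cond_true, cond_false] <;> congr 1 <;> ring
      · have := hν (l j)
        have := hν (r j)
        have : |(bif b then 1 / 2 else -(1 / 2) : ℝ)| = 1 / 2 := by
          cases b <;> simp [abs_of_pos]
        rw [this, abs_of_pos (by norm_num : (0 : ℝ) < 1 / 2)]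
        simp only [sqStateNorm, abs_zero]
        linarith
    · exact ⟨none, none, none, 1, 0, 0, fun x hx => by simp [sqState, sqApprox, h1 x hx],
        by simpa [sqStateNorm] using hν1⟩
  have hsq := hstart.sqState hu hcard m
  refine ⟨fun x o => o.elim 1 fun j =>
      |sqApprox m (|(φ x (some (l j)) + φ x (some (r j))) / 2|)
        - sqApprox m (|(φ x (some (l j)) - φ x (some (r j))) / 2|)|,
    fun o => o.elim 1 fun _ => 4 * c + 6, ?_, fun _ _ => rfl, le_rfl,
    fun x hx j => ⟨abs_nonneg _, (abs_sqApprox_sub_le (hφ x hx _) (hφ x hx _) m).1⟩,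
    fun x hx j => ?_, fun _ => le_rfl⟩
  · rw [show i + (m + 2) = i + 1 + m + 1 by omega]
    refine hsq.step ?_ ?_
    · rw [Fintype.card_option]; omega
    rintro (_ | j)
    · exact ⟨none, none, none, 1, 0, 0, fun x hx => by simp [sqState], by simp [sqStateNorm]⟩
    · refine ⟨some ((j, true), true), some ((j, false), true), none, 1, -1, 0, fun x hx => ?_, ?_⟩
      · simp only [sqState, u, cond_true, cond_false, Option.elim]
        congr 1
        ring
      · have hc : 0 ≤ c := (hR.nonneg _).trans (hν (l j))
        have : 0 ≤ (c + 1) * (1 / 2 ^ m) := by positivity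
        simp only [sqStateNorm, abs_neg, abs_one, abs_zero, Option.elim]
        linarith
  · have ha := hφ x hx (l j)
    have hb := hφ x hx (r j)
    have h1 := (abs_sqApprox_sub_le ha hb m).2
    have h2 := hφV x hx (l j)
    have h3 := hφV x hx (r j)
    have hv := hV x hx (l j)
    simp only [Option.elim]
    set a := φ x (some (l j))
    set b := φ x (some (r j))
    have h4 : |a * b - V x (l j) * V x (r j)| ≤ 2 * e := by
      have : a * b - V x (l j) * V x (r j) = (a - V x (l j)) * b + V x (l j) * (b - V x (r j)) := by
        ring
      rw [this]
      refine (abs_add_le _ _).trans ?_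
      rw [abs_mul, abs_mul, abs_of_nonneg hb.1, abs_of_nonneg hv.1]
      have := mul_le_of_le_one_right (abs_nonneg (a - V x (l j))) hb.2
      have := mul_le_of_le_one_left (abs_nonneg (b - V x (r j))) hv.2
      linarith
    have := abs_sub_le (|sqApprox m (|(a + b) / 2|) - sqApprox m (|(a - b) / 2|)|) (a * b)
      (V x (l j) * V x (r j))
    linarith

/-- Products of `2 ^ q` functions, with `σ` indexing the products. -/
theorem Approximates.prod {σ : Type} [Fintype σ] {y : (ℕ → ℝ) → σ → ℕ → ℝ} {c : ℝ} {q m : ℕ}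
    (hy : ∀ x ∈ X, ∀ k j, y x k j ∈ Set.Icc (0 : ℝ) 1)
    (hB : 4 * (Fintype.card σ * 2 ^ q) + 1 ≤ B)
    (h : Approximates n X B i (σ × Fin (2 ^ q)) (fun x k => y x k.1 k.2) c 0) :
    ∀ s r, r + s = q → Approximates n X B (i + s * (m + 2)) (σ × Fin (2 ^ r))
      (fun x k => ∏ t ∈ Finset.range (2 ^ s), y x k.1 (k.2 * 2 ^ s + t))
      (4 ^ s * (c + 2) - 2) ((2 ^ s - 1) / 4 ^ m) := by
  intro s
  induction s with
  | zero =>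
    rintro r rfl
    simpa using h
  | succ s ih =>
    intro r hr
    have hlt : ∀ j : Fin (2 ^ r), 2 * (j : ℕ) + 1 < 2 ^ (r + 1) := fun j => by
      have := j.2
      rw [pow_succ]
      omega
    have hle : 4 * Fintype.card (σ × Fin (2 ^ r)) + 1 ≤ B := by
      refine le_trans ?_ hB
      rw [Fintype.card_prod, Fintype.card_fin]
      gcongr
      · norm_num
      · omega
    have := (ih (r + 1) (by omega)).mul (ι' := σ × Fin (2 ^ r)) ?_ hle
      (fun k => (k.1, ⟨2 * k.2, (Nat.lt_succ_self _).trans (hlt k.2)⟩))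
      (fun k => (k.1, ⟨2 * k.2 + 1, hlt k.2⟩)) m
    · convert this using 1
      · ring
      · funext x k
        simp only
        rw [pow_succ, mul_two, Finset.prod_range_add]
        congr 1 <;> refine Finset.prod_congr rfl fun t _ => ?_ <;> congr 1 <;> ring
      · ring
      · ring
    · exact fun x hx k => ⟨Finset.prod_nonneg fun t _ => (hy x hx _ _).1,
        Finset.prod_le_one (fun t _ => (hy x hx _ _).1) fun t _ => (hy x hx _ _).2⟩

/-- A linear combination of the approximated functions is the output of a network. -/
theorem Approximates.exists_nn [Fintype ι] {V : (ℕ → ℝ) → ι → ℝ} {c e : ℝ}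
    (h : Approximates n X B i ι V c e) (hB : 1 ≤ B) (a : ι → ℝ) :
    ∃ (p : ℕ → ℕ) (_ : p 0 = n) (_ : p (i + 1) = 1) (f : NN p), (∀ j ≤ i + 1, p j ≤ B) ∧
      f.normTimes i ≤ (∑ k, |a k|) * c ∧
      ∀ x ∈ X, ∃ v : ι → ℝ, (∀ k, |v k - V x k| ≤ e) ∧
        ∀ z : Fin (p 0) → ℝ, (∀ j, z j = x j) → ∑ j, f.eval absAct i z j = ∑ k, a k * v k := by
  obtain ⟨φ, ν, hR, -, -, -, hφV, hν⟩ := h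
  obtain ⟨p, M, e, h0, hpB, hlin, hnorm⟩ := hR.linOut (κ' := Unit) (by simpa using hB)
    fun _ o => o.elim 0 a
  have hp1 : p (i + 1) = 1 := by simpa using (Fintype.card_congr e).symm
  have he : ((e () : Fin (p (i + 1))) : ℕ) = 0 := by have := (e ()).2; omega
  refine ⟨p, h0, hp1, ofNat p M, hpB, ?_, fun x hx => ⟨fun k => φ x (some k), hφV x hx,
    fun z hz => ?_⟩⟩
  · simp only [normTimes, abs_of_nonneg (absProd_ofNat_nonneg p M _ _ _), sum_absProd_ofNat]
    rw [← Finset.sum_range fun j => rowNorm p M (i + 1) j, hp1, Finset.sum_range_one, ← he]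
    refine (hnorm ()).trans ?_
    rw [Fintype.sum_option, Finset.sum_mul]
    simp only [Option.elim, abs_zero, zero_mul, zero_add]
    exact Finset.sum_le_sum fun k _ => mul_le_mul_of_nonneg_left (hν k) (abs_nonneg _)
  · simp only [eval, pre_ofNat p M z x hz]
    rw [← Finset.sum_range fun j => NN.linOut p M i (post p M x i) j, hp1, Finset.sum_range_one,
      ← he, hlin x hx, Fintype.sum_option]
    simp

end NN

/-- A monomial of degree at most `N` is a product of `N` factors chosen among its variables
and `1`. -/
theorem exists_factorization {d N : ℕ} (k : Fin d → ℕ) (hk : ∑ i, k i ≤ N) :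
    ∃ g : ℕ → Fin (d + 1), ∀ y : Fin (d + 1) → ℝ, y 0 = 1 →
      ∏ t ∈ Finset.range N, y (g t) = ∏ i, y i.succ ^ k i := by
  let s : Multiset (Fin (d + 1)) :=
    ∑ i, Multiset.replicate (k i) i.succ + Multiset.replicate (N - ∑ i, k i) 0
  have hs : s.toList.length = N := by
    simp [s]
    omega
  refine ⟨fun t => s.toList.getD t 0, fun y hy => ?_⟩
  have h1 : (s.map y).prod = ∏ i, y i.succ ^ k i := by
    simp only [s, Multiset.map_add, Multiset.prod_add, Multiset.map_replicate,
      Multiset.prod_replicate, hy, one_pow, mul_one]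
    rw [← Multiset.coe_mapAddMonoidHom, map_sum, Multiset.prod_sum]
    simp
  rw [← h1, ← Multiset.prod_map_toList, ← hs, Finset.prod_range, ← List.prod_ofFn]
  congr 1
  apply List.ext_getElem <;> simp

theorem abs_sum_sub_tsum_le {κ : Type*} {a P : κ → ℝ} (S : Finset κ) (v : S → ℝ) {η : ℝ}
    (ha : Summable fun k => |a k|) (hP : ∀ k, |P k| ≤ 1) (hv : ∀ k : S, |v k - P k| ≤ η)
    (hS : ∀ k ∉ S, |P k| ≤ η) :
    |∑ k : S, a k * v k - ∑' k, a k * P k| ≤ (∑' k, |a k|) * η := by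
  classical
  let w : κ → ℝ := fun k => if h : k ∈ S then v ⟨k, h⟩ else 0
  have hw : HasSum (fun k => a k * w k) (∑ k : S, a k * v k) := by
    have : ∑ k : S, a k * v k = ∑ k ∈ S, a k * w k := by
      rw [← Finset.sum_coe_sort S]
      exact Finset.sum_congr rfl fun k _ => by simp [w]
    rw [this]
    exact hasSum_sum_of_ne_finset_zero fun k hk => by simp [w, hk]
  have hs : Summable fun k => a k * P k := by
    refine Summable.of_norm_bounded ha fun k => ?_
    rw [Real.norm_eq_abs, abs_mul]
    exact mul_le_of_le_one_right (abs_nonneg _) (hP k)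
  rw [← hw.tsum_eq, ← hw.summable.tsum_sub hs]
  refine tsum_of_norm_bounded (E := ℝ) (ha.hasSum.mul_right η) fun k => ?_
  rw [Real.norm_eq_abs, ← mul_sub, abs_mul]
  refine mul_le_mul_of_nonneg_left ?_ (abs_nonneg _)
  by_cases h : k ∈ S
  · simpa [w, h] using hv ⟨k, h⟩
  · simpa [w, h] using hS k h

theorem exists_depth_parameters {ε δ : ℝ} (hε : ε ∈ Set.Ioo (0 : ℝ) 1)
    (hδ : δ ∈ Set.Ioo (0 : ℝ) 1) :
    ∃ q m : ℕ, (1 - δ) ^ 2 ^ q ≤ ε ∧ (2 : ℝ) ^ q / 4 ^ m ≤ ε / δ ∧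
      (2 : ℝ) ^ q ≤ 2 * ((1 / δ) * (1 + Real.logb 2 (1 / ε))) ∧
      (((1 + q * (m + 2) : ℕ)) : ℝ) ≤
        13 * (1 + Real.logb 2 (1 / δ)) * (1 + Real.logb 2 (1 / ε)) ^ 2 := by
  obtain ⟨hε0, hε1⟩ := hε
  obtain ⟨hδ0, hδ1⟩ := hδ
  have hlog2 : 1 / 2 < Real.log 2 := by linarith [Real.log_two_gt_d9]
  have hlog2' : Real.log 2 < 1 := by linarith [Real.log_two_lt_d9]
  have hD1 : 1 < 1 / δ := (one_lt_div hδ0).2 hδ1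
  have hlD : 0 ≤ Real.logb 2 (1 / δ) := Real.logb_nonneg one_lt_two hD1.le
  have hlE : 0 ≤ Real.logb 2 (1 / ε) := Real.logb_nonneg one_lt_two ((one_lt_div hε0).2 hε1).le
  have hpow : (2 : ℝ) ^ (1 + Real.logb 2 (1 / ε)) = 2 / ε := by
    rw [Real.rpow_add two_pos, Real.rpow_one, Real.rpow_logb two_pos (by norm_num) (by positivity)]
    ring
  have hεE : -(1 + Real.logb 2 (1 / ε)) ≤ Real.log ε := by
    have h0 : 0 ≤ -Real.log ε := neg_nonneg.2 (Real.log_nonpos hε0.le hε1.le)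
    have : -Real.log ε ≤ Real.logb 2 (1 / ε) := by
      rw [Real.logb, one_div, Real.log_inv, le_div_iff₀ (by linarith)]
      nlinarith
    linarith
  set E := 1 + Real.logb 2 (1 / ε)
  have hE1 : 1 ≤ E := by linarith
  set D := 1 / δ with hD
  have hDδ : D * δ = 1 := one_div_mul_cancel hδ0.ne'
  have hDE : 1 ≤ D * E := by nlinarith
  have hlogE : Real.logb 2 E ≤ 2 * E := by
    rw [Real.logb, div_le_iff₀ (by linarith)]
    nlinarith [Real.log_le_sub_one_of_pos (by linarith : 0 < E)]
  have hlDE : Real.logb 2 (D * E) = Real.logb 2 D + Real.logb 2 E :=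
    Real.logb_mul (by positivity) (by positivity)
  have hl0 : 0 ≤ Real.logb 2 (D * E) := Real.logb_nonneg one_lt_two hDE
  have hrp : (2 : ℝ) ^ Real.logb 2 (D * E) = D * E :=
    Real.rpow_logb two_pos (by norm_num) (by positivity)
  obtain ⟨q, hq1, hq2⟩ : ∃ q : ℕ, Real.logb 2 (D * E) ≤ q ∧ (q : ℝ) ≤ 1 + Real.logb 2 (D * E) :=
    ⟨⌈Real.logb 2 (D * E)⌉₊, Nat.le_ceil _, by linarith [Nat.ceil_lt_add_one hl0]⟩
  obtain ⟨m, hm1, hm2⟩ : ∃ m : ℕ, E ≤ m ∧ (m : ℝ) ≤ 1 + E :=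
    ⟨⌈E⌉₊, Nat.le_ceil _, by linarith [Nat.ceil_lt_add_one (by linarith : 0 ≤ E)]⟩
  have hql : D * E ≤ 2 ^ q := by
    rw [← hrp, ← Real.rpow_natCast]
    exact Real.rpow_le_rpow_of_exponent_le one_le_two hq1
  have hqu : (2 : ℝ) ^ q ≤ 2 * (D * E) := by
    rw [← hrp, ← Real.rpow_natCast]
    refine (Real.rpow_le_rpow_of_exponent_le one_le_two hq2).trans ?_
    rw [Real.rpow_add two_pos, Real.rpow_one]
  have hm3 : 2 / ε ≤ 2 ^ m := by
    rw [← hpow, ← Real.rpow_natCast]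
    exact Real.rpow_le_rpow_of_exponent_le one_le_two hm1
  have hm4 : E ≤ 2 ^ m := hm1.trans (by exact_mod_cast Nat.lt_two_pow_self.le)
  refine ⟨q, m, ?_, ?_, hqu, ?_⟩
  · have h1 : 1 - δ ≤ Real.exp (-δ) := by linarith [Real.add_one_le_exp (-δ)]
    calc (1 - δ) ^ 2 ^ q ≤ Real.exp (-δ) ^ 2 ^ q := pow_le_pow_left₀ (by linarith) h1 _
      _ = Real.exp (-(δ * 2 ^ q)) := by rw [← Real.exp_nat_mul]; push_cast; ring_nf
      _ ≤ Real.exp (Real.log ε) := by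
        refine Real.exp_le_exp.2 (le_trans (neg_le_neg ?_) hεE)
        nlinarith
      _ = ε := Real.exp_log hε0
  · have h4 : (4 : ℝ) ^ m = 2 ^ m * 2 ^ m := by rw [← mul_pow]; norm_num
    have : 2 / ε * E ≤ 4 ^ m := by
      rw [h4]
      exact mul_le_mul hm3 hm4 (by linarith) (by positivity)
    rw [div_le_iff₀ (by positivity)]
    calc (2 : ℝ) ^ q ≤ 2 * (D * E) := hqu
      _ = ε / δ * (2 / ε * E) := by rw [hD]; field_simp
      _ ≤ _ := mul_le_mul_of_nonneg_left this (by positivity)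
  · push_cast
    have h1 : (q : ℝ) ≤ 3 * E * (1 + Real.logb 2 D) := by nlinarith
    have h2 : (m : ℝ) + 2 ≤ 4 * E := by linarith
    have h3 := mul_le_mul h1 h2 (by positivity) (by positivity)
    have h4 : 1 ≤ (1 + Real.logb 2 D) * E ^ 2 := by nlinarith
    nlinarith

/-- Theorem 1: approximation of analytic functions `f(x) = ∑_k a_k x^k` with
`∑_k |a_k| ≤ F` on `(0, 1-δ]^d` by networks with the absolute value activation whose
depth, width and `‖·‖_×` all have logarithmic dependence on `1/ε` (and polynomial
dependence on `1/δ`), with constants depending only on `d`. -/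
theorem analytic_approx (d : ℕ) (hd : 0 < d) :
    ∃ c₁ c₂ c₃ : ℝ, 0 < c₁ ∧ 0 < c₂ ∧ 0 < c₃ ∧
      ∀ (a : (Fin d → ℕ) → ℝ) (F : ℝ),
        (Summable fun k : Fin d → ℕ => |a k|) → (∑' k : Fin d → ℕ, |a k|) ≤ F →
        ∀ ε δ : ℝ, ε ∈ Set.Ioo (0 : ℝ) 1 → δ ∈ Set.Ioo (0 : ℝ) 1 →
          ∃ (L : ℕ) (p : ℕ → ℕ) (h0 : p 0 = d + 1) (_ : p (L + 1) = 1) (f : NN p),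
            (L : ℝ) ≤ c₁ * (1 + Real.logb 2 (1 / δ)) * (1 + Real.logb 2 (1 / ε)) ^ 2 ∧
            (∀ i ≤ L + 1,
              (p i : ℝ) ≤ c₂ * (1 / δ) ^ (d + 1) * (1 + Real.logb 2 (1 / ε)) ^ (d + 2)) ∧
            f.normTimes L ≤ c₃ * F * (d + 1) * (1 / δ) ^ 5 * (1 + Real.logb 2 (1 / ε)) ^ 5 ∧
            ∀ x : Fin d → ℝ, (∀ i, x i ∈ Set.Ioc (0 : ℝ) (1 - δ)) →
              |(∑ j, f.eval absAct L (Fin.cons 1 x ∘ Fin.cast h0) j)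
                  - ∑' k : Fin d → ℕ, a k * ∏ i, x i ^ k i|
                ≤ 2 * F * ε / δ ^ 2 := by
  refine ⟨13, 5 * 2 ^ d * 2 ^ (d + 1), 12, by norm_num, by positivity, by norm_num, ?_⟩
  intro a F ha haF ε δ hε hδ
  obtain ⟨q, m, htail, herr, hq, hL⟩ := exists_depth_parameters hε hδ
  obtain ⟨hε0, hε1⟩ := hε
  obtain ⟨hδ0, hδ1⟩ := hδ
  have hD1 : 1 ≤ 1 / δ := (one_le_div hδ0).2 hδ1.le
  have hE1 : 1 ≤ 1 + Real.logb 2 (1 / ε) :=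
    le_add_of_nonneg_right (Real.logb_nonneg one_lt_two ((one_le_div hε0).2 hε1.le))
  set E := 1 + Real.logb 2 (1 / ε)
  have hF : 0 ≤ F := (tsum_nonneg fun k => abs_nonneg (a k)).trans haF
  let S : Finset (Fin d → ℕ) :=
    (Fintype.piFinset fun _ => Finset.range (2 ^ q + 1)).filter fun k => ∑ i, k i ≤ 2 ^ q
  have hSmem : ∀ k, k ∈ S ↔ ∑ i, k i ≤ 2 ^ q := fun k => by
    simp only [S, Finset.mem_filter, Fintype.mem_piFinset, Finset.mem_range, and_iff_right_iff_imp]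
    exact fun h i => Nat.lt_succ_of_le
      ((Finset.single_le_sum (fun j _ => Nat.zero_le (k j)) (Finset.mem_univ i)).trans h)
  have hScard : Fintype.card S ≤ (2 ^ q + 1) ^ d := by
    rw [Fintype.card_coe]
    refine (Finset.card_filter_le _ _).trans (le_of_eq ?_)
    simp
  have hg : ∀ k : S, _ := fun k => exists_factorization k.1 ((hSmem k).1 k.2)
  choose g hg using hg
  let B : ℕ := 5 * 2 ^ d * (2 ^ q) ^ (d + 1)
  have hdB : d + 1 ≤ B := by
    have h1 : d + 1 ≤ 2 ^ d := Nat.lt_two_pow_self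
    have h2 : 1 ≤ (2 ^ q) ^ (d + 1) := Nat.one_le_pow _ _ (by positivity)
    calc d + 1 ≤ 2 ^ d := h1
      _ ≤ 5 * 2 ^ d * 1 := by omega
      _ ≤ B := Nat.mul_le_mul_left _ h2
  have hB : 4 * (Fintype.card S * 2 ^ q) + 1 ≤ B := by
    have h1 : 1 ≤ 2 ^ q := Nat.one_le_two_pow
    have h2 : Fintype.card S ≤ (2 * 2 ^ q) ^ d := hScard.trans (Nat.pow_le_pow_left (by omega) d)
    have h3 : 1 ≤ (2 * 2 ^ q) ^ d * 2 ^ q := Nat.one_le_iff_ne_zero.2 (by positivity)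
    have h4 := Nat.mul_le_mul_right (2 ^ q) h2
    calc 4 * (Fintype.card S * 2 ^ q) + 1 ≤ 5 * ((2 * 2 ^ q) ^ d * 2 ^ q) := by omega
      _ = B := by simp only [B, mul_pow, pow_succ]; ring
  let X : Set (ℕ → ℝ) := {x | x 0 = 1 ∧ ∀ j, x j ∈ Set.Icc (0 : ℝ) 1}
  have hleaf : NN.Approximates (d + 1) X B 1 (S × Fin (2 ^ q)) (fun x k => x (g k.1 k.2)) 1 0 := by
    refine ⟨fun x o => o.elim 1 fun k => x (g k.1 k.2), fun _ => 1,
      (NN.reach_input hdB).step ?_ ?_, fun _ _ => rfl, le_rfl, fun x hx k => hx.2 _,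
      fun x hx k => by simp, fun _ => le_rfl⟩
    · rw [Fintype.card_option, Fintype.card_prod, Fintype.card_fin]
      omega
    · rintro (_ | k)
      · exact ⟨0, 0, 0, 1, 0, 0, fun x hx => by simp [hx.1], by simp⟩
      · exact ⟨g k.1 k.2, 0, 0, 1, 0, 0, fun x hx => by simp [abs_of_nonneg (hx.2 _).1], by simp⟩
  obtain ⟨p, h0, h1, f, hpB, hfn, hf⟩ :=
    (NN.Approximates.prod (y := fun x k j => x (g k j)) (m := m) (fun x hx _ _ => hx.2 _) hB hleaf
      q 0 (zero_add q)).exists_nn (by omega) fun k => a k.1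
  refine ⟨1 + q * (m + 2), p, h0, h1, f, hL, fun i hi => ?_, ?_, fun x hx => ?_⟩
  · calc (p i : ℝ) ≤ (B : ℝ) := by exact_mod_cast hpB i hi
      _ = 5 * 2 ^ d * (2 ^ q) ^ (d + 1) := by simp [B]
      _ ≤ 5 * 2 ^ d * (2 * ((1 / δ) * E)) ^ (d + 1) := by gcongr
      _ = 5 * 2 ^ d * 2 ^ (d + 1) * (1 / δ) ^ (d + 1) * E ^ (d + 1) := by
        rw [mul_pow, mul_pow]; ring
      _ ≤ _ := by gcongr; omega
  · have hsum : ∑ k : S × Fin (2 ^ 0), |a k.1| ≤ F := by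
      rw [Fintype.sum_prod_type]
      simp only [Finset.sum_const, Finset.card_univ, Fintype.card_fin, pow_zero, one_smul]
      rw [Finset.sum_coe_sort S fun k => |a k|]
      exact (ha.sum_le_tsum S fun k _ => abs_nonneg _).trans haF
    have h4 : (4 : ℝ) ^ q = 2 ^ q * 2 ^ q := by rw [← mul_pow]; norm_num
    have h40 : (1 : ℝ) ≤ 4 ^ q := one_le_pow₀ (by norm_num)
    have hD5 : (1 / δ) ^ 2 ≤ (1 / δ) ^ 5 := pow_le_pow_right₀ hD1 (by norm_num)
    have hE5 : E ^ 2 ≤ E ^ 5 := pow_le_pow_right₀ hE1 (by norm_num)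
    calc _ ≤ _ := hfn
      _ ≤ F * (4 ^ q * (1 + 2)) := mul_le_mul hsum (by linarith) (by linarith) hF
      _ ≤ F * ((2 * ((1 / δ) * E)) * (2 * ((1 / δ) * E)) * 3) := by
        rw [h4]
        gcongr
        norm_num
      _ = 12 * F * 1 * (1 / δ) ^ 2 * E ^ 2 := by ring
      _ ≤ 12 * F * (d + 1) * (1 / δ) ^ 5 * E ^ 5 := by
        gcongr
        linarith [(Nat.cast_nonneg d : (0 : ℝ) ≤ d)]
  · let y : Fin (d + 1) → ℝ := Fin.cons 1 x
    let x' : ℕ → ℝ := fun j => if h : j < d + 1 then y ⟨j, h⟩ else 0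
    have hx'y : ∀ j : Fin (d + 1), x' j = y j := fun j => dif_pos j.2
    have hx01 : ∀ i, x i ∈ Set.Icc (0 : ℝ) 1 := fun i => ⟨(hx i).1.le, by linarith [(hx i).2]⟩
    have hy : ∀ j, y j ∈ Set.Icc (0 : ℝ) 1 := fun j => by
      refine Fin.cases ?_ (fun i => ?_) j
      · simp [y]
      · simpa [y] using hx01 i
    have hx'X : x' ∈ X := by
      refine ⟨by simp [x', y], fun j => ?_⟩
      simp only [x']
      by_cases h : j < d + 1
      · rw [dif_pos h]; exact hy ⟨j, h⟩
      · rw [dif_neg h]; simp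
    obtain ⟨v, hv, hfv⟩ := hf x' hx'X
    rw [hfv (Fin.cons 1 x ∘ Fin.cast h0) fun j => (hx'y (Fin.cast h0 j)).symm]
    have hη : ε / δ ≤ ε / δ ^ 2 := by
      gcongr
      nlinarith
    have hη' : ε ≤ ε / δ ^ 2 := by
      rw [le_div_iff₀ (by positivity)]
      exact mul_le_of_le_one_right hε0.le (pow_le_one₀ hδ0.le hδ1.le)
    have hmono : ∀ k : Fin d → ℕ, 0 ≤ ∏ i, x i ^ k i := fun k =>
      Finset.prod_nonneg fun i _ => pow_nonneg (hx01 i).1 _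
    have hmain := abs_sum_sub_tsum_le (P := fun k => ∏ i, x i ^ k i) (η := ε / δ ^ 2) S
      (fun k => v (k, 0)) ha (fun k => ?_) (fun k => ?_) fun k hk => ?_
    · rw [Fintype.sum_prod_type]
      have : ∀ k : S, ∑ j : Fin (2 ^ 0), a k * v (k, j) = a k * v (k, 0) := fun k =>
        Fin.sum_univ_one fun j : Fin 1 => a k * v (k, j)
      simp only [this]
      calc _ ≤ _ := hmain
        _ ≤ F * (ε / δ ^ 2) := by gcongr
        _ ≤ 2 * (F * (ε / δ ^ 2)) := by linarith [mul_nonneg hF (hε0.le.trans hη')]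
        _ = _ := by ring
    · rw [abs_of_nonneg (hmono k)]
      exact Finset.prod_le_one (fun i _ => pow_nonneg (hx01 i).1 _)
        fun i _ => pow_le_one₀ (hx01 i).1 (hx01 i).2
    · have hprod : ∏ t ∈ Finset.range (2 ^ q), x' (g k t) = ∏ i, x i ^ k.1 i := by
        simp only [hx'y]
        rw [hg k y (by simp [y])]
        simp [y]
      have := hv (k, 0)
      simp only [Fin.val_zero, zero_mul, zero_add, hprod] at this
      refine this.trans (le_trans ?_ (herr.trans hη))
      gcongr
      linarith
    · rw [hSmem, not_le] at hk
      rw [abs_of_nonneg (hmono k)]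
      calc ∏ i, x i ^ k i ≤ ∏ i, (1 - δ) ^ k i :=
            Finset.prod_le_prod (fun i _ => pow_nonneg (hx01 i).1 _)
              fun i _ => pow_le_pow_left₀ (hx01 i).1 (hx i).2 _
        _ = (1 - δ) ^ ∑ i, k i := Finset.prod_pow_eq_pow_sum _ _ _
        _ ≤ (1 - δ) ^ 2 ^ q := pow_le_pow_of_le_one (by linarith) (by linarith) hk.le
        _ ≤ _ := htail.trans hη'
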